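/- Let G be a finitely generated group, E an admissible family of subgroups of G, and T a minimal E-tree with basepoint vertex v₀. Let Y be a cylinder and v ∈ ∂Y a vertex of finite valence in Y. Then the peripheral almost invariant set X_{v,Y} is non-trivial, and X_{v,Y} crosses no almost invariant set of the form X_S, for S a special forest of T. Consequently the singleton {{[X_{v,Y}],[X_{v,Y}*]}} is a complete cross-connected component of B(T). -/

import Mathlib

open scoped Pointwise symmDiff

namespace SSRN

section Group
variable {G : Type*} [Group G]

/-- A subset of `G` is `H`-finite if it is contained in finitely many orbits of the
action of `H` on `G` by left multiplication. -/
def HFin (H : Subgroup G) (X : Set G) : Prop :=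
  ∃ F : Finset G, X ⊆ ⋃ f ∈ F, (· * f) '' (H : Set G)

/-- Two subsets of `G` are `H`-equivalent if their symmetric difference is `H`-finite. -/
def AIEquiv (H : Subgroup G) (X Y : Set G) : Prop := HFin H (X ∆ Y)

/-- `X` is an `H`-almost invariant subset of `G`. -/
def IsAI (H : Subgroup G) (X : Set G) : Prop :=
  (∀ h ∈ H, (h * ·) '' X = X) ∧ ∀ s : G, HFin H (((· * s) '' X) ∆ X)

/-- `X` is a non-trivial `H`-almost invariant subset of `G`. -/
def NontrivAI (H : Subgroup G) (X : Set G) : Prop :=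
  IsAI H X ∧ ¬ HFin H X ∧ ¬ HFin H Xᶜ

/-- The `H`-almost invariant set `X` crosses `Y`: none of the four corners is `H`-finite. -/
def Crosses (H : Subgroup G) (X Y : Set G) : Prop :=
  ¬ HFin H (X ∩ Y) ∧ ¬ HFin H (X ∩ Yᶜ) ∧ ¬ HFin H (Xᶜ ∩ Y) ∧ ¬ HFin H (Xᶜ ∩ Yᶜ)

/-- Crossing of (non-trivial) almost invariant sets, quantifying over the groups over
which they are almost invariant. -/
def CrossesAny (X X' : Set G) : Prop :=
  ∃ H K : Subgroup G, NontrivAI H X ∧ NontrivAI K X' ∧ Crosses H X X'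

/-- `X` and `X'` determine the same unordered pair `{[X], [X*]}` of equivalence classes. -/
def SamePair (X X' : Set G) : Prop :=
  ∃ H : Subgroup G, NontrivAI H X ∧ (HFin H (X ∆ X') ∨ HFin H (X ∆ X'ᶜ))

/-- An admissible family of subgroups: conjugacy invariant, closed under commensurability,
and no member contains another with infinite index. -/
def Admissible (E : Set (Subgroup G)) : Prop :=
  (∀ H ∈ E, ∀ g : G, (MulAut.conj g • H) ∈ E) ∧
  (∀ H ∈ E, ∀ K : Subgroup G, Subgroup.Commensurable K H → K ∈ E) ∧
  (∀ A ∈ E, ∀ B ∈ E, A ≤ B → A.relIndex B ≠ 0)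

end Group

section Tree

variable {V : Type*}

/-- The stabilizer of an edge `e : Sym2 V` under the action of `G`. -/
def edgeStab (G : Type*) [Group G] [MulAction G V] (e : Sym2 V) : Subgroup G where
  carrier := {g | Sym2.map (g • ·) e = e}
  one_mem' := by
    show Sym2.map ((1 : G) • ·) e = e
    have : ((1 : G) • · : V → V) = id := by funext v; simp
    rw [this, Sym2.map_id]; rfl
  mul_mem' := by
    intro a b ha hb
    show Sym2.map ((a * b) • ·) e = e
    have : ((a * b) • · : V → V) = (a • ·) ∘ (b • ·) := by funext v; simp [mul_smul]
    rw [this, ← Sym2.map_map, hb, ha]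
  inv_mem' := by
    intro a ha
    show Sym2.map (a⁻¹ • ·) e = e
    conv_lhs => rw [← ha]
    rw [Sym2.map_map]
    have : ((a⁻¹ • ·) ∘ (a • ·) : V → V) = id := by funext v; simp
    rw [this, Sym2.map_id]; rfl

variable (T : SimpleGraph V)

/-- `G` acts on the graph `T` by graph automorphisms. -/
def ActsOn (G : Type*) [Group G] [MulAction G V] : Prop :=
  ∀ (g : G) (u v : V), T.Adj u v → T.Adj (g • u) (g • v)

/-- The action of `G` on `T` is without inversions. -/
def NoInversions (G : Type*) [Group G] [MulAction G V] : Prop :=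
  ∀ (g : G) (u v : V), T.Adj u v → ¬ (g • u = v ∧ g • v = u)

/-- `w` lies between `u` and `v`: it is on every path from `u` to `v`. -/
def Btw (u w v : V) : Prop := ∀ p : T.Walk u v, p.IsPath → w ∈ p.support

/-- The action of `G` on the tree `T` is minimal: every nonempty invariant subtree
(convex invariant set of vertices) is the whole vertex set. -/
def MinimalAction (G : Type*) [Group G] [MulAction G V] : Prop :=
  ∀ A : Set V, A.Nonempty → (∀ (g : G), ∀ a ∈ A, g • a ∈ A) →
    (∀ u ∈ A, ∀ v ∈ A, ∀ w : V, Btw T u w v → w ∈ A) → A = Set.univ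

/-- The action of `G` is non-trivial: there is no global fixed vertex. -/
def NontrivialAction (G : Type*) [Group G] [MulAction G V] : Prop :=
  ¬ ∃ v : V, ∀ g : G, g • v = v

/-- `T` is an `E`-tree: all edge stabilizers belong to `E`. -/
def IsETree (G : Type*) [Group G] [MulAction G V] (E : Set (Subgroup G)) : Prop :=
  ∀ e ∈ T.edgeSet, edgeStab G e ∈ E

/-- There are finitely many `G`-orbits of edges. -/
def FinEdgeOrbits (G : Type*) [Group G] [MulAction G V] : Prop :=
  ∃ F : Finset (Sym2 V), ∀ e ∈ T.edgeSet, ∃ e₀ ∈ F, ∃ g : G, Sym2.map (g • ·) e₀ = e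

/-- A cylinder of `T`: an equivalence class of edges for commensurability of stabilizers. -/
def IsCylinder (G : Type*) [Group G] [MulAction G V] (Y : Set (Sym2 V)) : Prop :=
  Y.Nonempty ∧ Y ⊆ T.edgeSet ∧
    ∀ e ∈ Y, ∀ e' ∈ T.edgeSet,
      (e' ∈ Y ↔ Subgroup.Commensurable (edgeStab G e) (edgeStab G (V := V) e'))

/-- The set of vertices of a set of edges (e.g. of a cylinder). -/
def cylVerts (Y : Set (Sym2 V)) : Set V := {v | ∃ e ∈ Y, v ∈ e}

/-- The boundary of a cylinder: its vertices lying in another cylinder,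
i.e. incident to an edge outside the cylinder. -/
def cylBoundary (Y : Set (Sym2 V)) : Set V :=
  {v | v ∈ cylVerts Y ∧ ∃ e ∈ T.edgeSet, v ∈ e ∧ e ∉ Y}

/-- `H` belongs to the commensurability class associated to the cylinder `Y`. -/
def InClassOf (G : Type*) [Group G] [MulAction G V] (Y : Set (Sym2 V)) (H : Subgroup G) : Prop :=
  ∃ e ∈ Y, Subgroup.Commensurable H (edgeStab G e)

/-- The coboundary of a set of vertices: edges with exactly one endpoint in it. -/
def cobdry (S : Set V) : Set (Sym2 V) :=
  {e | e ∈ T.edgeSet ∧ ∃ u v : V, e = s(u, v) ∧ u ∈ S ∧ v ∉ S}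

/-- `S` is a special forest based on the cylinder `Y`. -/
def IsSpecialForest (S : Set V) (Y : Set (Sym2 V)) : Prop :=
  (cobdry T S).Finite ∧ cobdry T S ⊆ Y

/-- A set of vertices is non-trivial if it is neither finite nor cofinite. -/
def NontrivForest (S : Set V) : Prop := ¬ S.Finite ∧ ¬ (Sᶜ : Set V).Finite

/-- The almost invariant set associated to a set of vertices. -/
def XS (G : Type*) [Group G] [MulAction G V] (v₀ : V) (S : Set V) : Set G :=
  {g : G | g • v₀ ∈ S}

/-- The component `T_e` of `T` minus the open edge `e = s(u,v)` containing the terminal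
vertex `v`. -/
def halfTree (u v : V) : Set V :=
  {w | ∃ p : T.Walk v w, p.IsPath ∧ s(u, v) ∉ p.edges}

/-- The almost invariant set `Z_e` dual to the oriented edge `(u, v)`. -/
def Ze (G : Type*) [Group G] [MulAction G V] (v₀ u v : V) : Set G :=
  XS G v₀ (halfTree T u v)

/-- `v` has finitely many incident edges in `Y`. -/
def FiniteValenceIn (Y : Set (Sym2 V)) (v : V) : Prop := {e | e ∈ Y ∧ v ∈ e}.Finite

/-- The peripheral special forest `S_{v,Y}`: the component of `v` in `T` minus the open
edges of `Y` incident to `v`. -/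
def periForest (Y : Set (Sym2 V)) (v : V) : Set V :=
  {w | ∃ p : T.Walk v w, p.IsPath ∧ ∀ e ∈ Y, v ∈ e → e ∉ p.edges}

/-- The peripheral almost invariant set `X_{v,Y}`. -/
def XvY (G : Type*) [Group G] [MulAction G V] (v₀ : V) (Y : Set (Sym2 V)) (v : V) : Set G :=
  XS G v₀ (periForest T Y v)

/-- A peripheral special forest: one equivalent to some `S_{v,Y}`. -/
def PeripheralForest (G : Type*) [Group G] [MulAction G V] (S : Set V) : Prop :=
  ∃ (Y : Set (Sym2 V)) (v : V), IsCylinder T G Y ∧ v ∈ cylBoundary T Y ∧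
    FiniteValenceIn Y v ∧ (S ∆ periForest T Y v).Finite

/-- The Boolean algebra `B_C(T)` of (representatives of) almost invariant sets based on the
cylinder `Y`: the smallest family containing the sets `Z_e`, `e ∈ Y`, closed under
complement, intersection and `H`-equivalence. -/
def BCT {G : Type*} [Group G] [MulAction G V] (v₀ : V) (Y : Set (Sym2 V)) (H : Subgroup G) :
    Set (Set G) :=
  ⋂₀ {F : Set (Set G) |
    (∀ u v : V, T.Adj u v → s(u, v) ∈ Y → Ze T G v₀ u v ∈ F) ∧
    (∀ X ∈ F, Xᶜ ∈ F) ∧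
    (∀ X ∈ F, ∀ X' ∈ F, X ∩ X' ∈ F) ∧
    (∀ X ∈ F, ∀ X' : Set G, HFin H (X ∆ X') → X' ∈ F)}

/-- The set `B(T)` of (representatives of) almost invariant sets based on `T`. -/
def BT (G : Type*) [Group G] [MulAction G V] (v₀ : V) : Set (Set G) :=
  {X | ∃ Y : Set (Sym2 V), IsCylinder T G Y ∧ ∃ e ∈ Y, X ∈ BCT T v₀ Y (edgeStab G e)}

/-- Elements of `B(T)` that are non-trivial almost invariant sets. -/
def NontrivB (G : Type*) [Group G] [MulAction G V] (v₀ : V) : Set (Set G) :=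
  {X | X ∈ BT T G v₀ ∧ ∃ H : Subgroup G, NontrivAI H X}

/-- One step of the relation generating cross-connected components. -/
def ccStep (G : Type*) [Group G] [MulAction G V] (v₀ : V) (X X' : Set G) : Prop :=
  X ∈ NontrivB T G v₀ ∧ X' ∈ NontrivB T G v₀ ∧ (CrossesAny X X' ∨ SamePair X X')

/-- The equivalence relation generated by crossing (and identification of equivalent sets
and complements) on `B(T)`. -/
def ccRel (G : Type*) [Group G] [MulAction G V] (v₀ : V) : Set G → Set G → Prop :=
  Relation.EqvGen (ccStep T G v₀)

/-- The cross-connected component of (the pair determined by) `X`. -/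
def ccOf (G : Type*) [Group G] [MulAction G V] (v₀ : V) (X : Set G) : Set (Set G) :=
  {X' | ccRel T G v₀ X X'}

/-- `C` is a cross-connected component of `B(T)`. -/
def IsCCC (G : Type*) [Group G] [MulAction G V] (v₀ : V) (C : Set (Set G)) : Prop :=
  ∃ X ∈ NontrivB T G v₀, C = ccOf T G v₀ X

/-- A cross-connected component is based on the cylinder `Y` if its members are almost
invariant over subgroups in the commensurability class of `Y`. -/
def CCCBasedOn (G : Type*) [Group G] [MulAction G V] (Y : Set (Sym2 V)) (C : Set (Set G)) :
    Prop :=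
  ∃ X ∈ C, ∃ H : Subgroup G, InClassOf G Y H ∧ NontrivAI H X

/-- A peripheral cross-connected component. -/
def PeripheralCCC (G : Type*) [Group G] [MulAction G V] (v₀ : V) (C : Set (Set G)) : Prop :=
  ∃ (Y : Set (Sym2 V)) (v : V), IsCylinder T G Y ∧ v ∈ cylBoundary T Y ∧
    FiniteValenceIn Y v ∧ XvY T G v₀ Y v ∈ C

/-- Betweenness of (distinct) cross-connected components. -/
def CCCBetween {G : Type*} [Group G] (C₁ C₂ C₃ : Set (Set G)) : Prop :=
  C₁ ≠ C₂ ∧ C₂ ≠ C₃ ∧ C₁ ≠ C₃ ∧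
    ∃ X₁ ∈ C₁, ∃ X₂ ∈ C₂, ∃ X₃ ∈ C₃, X₁ ⊆ X₂ ∧ X₂ ⊆ X₃

/-- A star of cross-connected components. -/
def IsStar (G : Type*) [Group G] [MulAction G V] (v₀ : V) (St : Set (Set (Set G))) : Prop :=
  (∀ C ∈ St, IsCCC T G v₀ C) ∧ St.Nontrivial ∧
  (∀ C ∈ St, ∀ C' ∈ St, ∀ C'' : Set (Set G), IsCCC T G v₀ C'' → ¬ CCCBetween C C'' C') ∧
  (∀ St' : Set (Set (Set G)), St ⊆ St' → (∀ C ∈ St', IsCCC T G v₀ C) →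
    (∀ C ∈ St', ∀ C' ∈ St', ∀ C'' : Set (Set G), IsCCC T G v₀ C'' → ¬ CCCBetween C C'' C') →
    St' = St)

/-- The regular neighbourhood `RN(B(T))`: the bipartite graph on cross-connected
components and stars. -/
def RNGraph (G : Type*) [Group G] [MulAction G V] (v₀ : V) :
    SimpleGraph ({C : Set (Set G) // IsCCC T G v₀ C} ⊕
      {St : Set (Set (Set G)) // IsStar T G v₀ St}) where
  Adj x y :=
    match x, y with
    | Sum.inl C, Sum.inr St => C.1 ∈ St.1
    | Sum.inr St, Sum.inl C => C.1 ∈ St.1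
    | _, _ => False
  symm := ⟨by rintro (C | St) (C' | St') h <;> exact h⟩
  loopless := ⟨by rintro (C | St) h <;> exact h⟩

/-- Vertices of `T` lying in at least two cylinders. -/
def TcV0 (G : Type*) [Group G] [MulAction G V] : Set V :=
  {v | ∃ Y Y' : Set (Sym2 V), IsCylinder T G Y ∧ IsCylinder T G Y' ∧ Y ≠ Y' ∧
    v ∈ cylVerts Y ∧ v ∈ cylVerts Y'}

/-- The tree of cylinders `T_c` of `T`, as a bipartite graph. -/
def TcGraph (G : Type*) [Group G] [MulAction G V] :
    SimpleGraph ({v : V // v ∈ TcV0 T G} ⊕ {Y : Set (Sym2 V) // IsCylinder T G Y}) where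
  Adj x y :=
    match x, y with
    | Sum.inl v, Sum.inr Y => v.1 ∈ cylVerts Y.1
    | Sum.inr Y, Sum.inl v => v.1 ∈ cylVerts Y.1
    | _, _ => False
  symm := ⟨by rintro (v | Y) (v' | Y') h <;> exact h⟩
  loopless := ⟨by rintro (v | Y) h <;> exact h⟩


/-- `T` dominates `T'`: there is a `G`-equivariant map. -/
def Dominates (G : Type*) [Group G] {V V' : Type*} [MulAction G V] [MulAction G V']
    (T : SimpleGraph V) (T' : SimpleGraph V') : Prop :=
  ∃ f : V → V', ∀ (g : G) (x : V), f (g • x) = g • f x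

end Tree

section Subdiv

variable {α β : Type*}

/-- `S` is a subdivision of `Γ` via the vertex embedding `f`. -/
def SubdivVia (f : α → β) (S : SimpleGraph β) (Γ : SimpleGraph α) : Prop :=
  Function.Injective f ∧
  (∀ b : β, b ∉ Set.range f → ∃ x y : β, x ≠ y ∧ S.neighborSet b = {x, y}) ∧
  (∀ u : α, Nonempty (Γ.neighborSet u ≃ S.neighborSet (f u))) ∧
  (∀ u v : α, Γ.Adj u v ↔ ∃ p : S.Walk (f u) (f v), p.IsPath ∧ 1 ≤ p.length ∧
      ∀ w ∈ p.support, w ∈ Set.range f → w = f u ∨ w = f v) ∧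
  (∀ e ∈ S.edgeSet, ∃ (u v : α) (p : S.Walk (f u) (f v)), Γ.Adj u v ∧ p.IsPath ∧
      (∀ w ∈ p.support, w ∈ Set.range f → w = f u ∨ w = f v) ∧ e ∈ p.edges)

/-- `S` is (isomorphic to) a subdivision of `Γ`. -/
def IsSubdivision (S : SimpleGraph β) (Γ : SimpleGraph α) : Prop :=
  ∃ f : α → β, SubdivVia f S Γ

end Subdiv

end SSRN

namespace SSRN

variable {G V : Type*} [Group G] [MulAction G V]

/-- The subgroup over which the peripheral set `X_{v,Y}` is almost invariant:
the intersection of the stabilizers of the edges of `Y` incident to `v`. -/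
def periStab (G : Type*) [Group G] [MulAction G V] (Y : Set (Sym2 V)) (v : V) : Subgroup G :=
  ⨅ e ∈ {e : Sym2 V | e ∈ Y ∧ v ∈ e}, edgeStab G e


end SSRN

namespace SSRN

section GroupLemmas
variable {G : Type*} [Group G]

lemma hfin_iff (H : Subgroup G) (X : Set G) :
    HFin H X ↔ ∃ F : Finset G, ∀ x ∈ X, ∃ f ∈ F, x * f⁻¹ ∈ H := by
  constructor
  · rintro ⟨F, hF⟩
    refine ⟨F, fun x hx => ?_⟩
    have := hF hx
    simp only [Set.mem_iUnion] at this
    obtain ⟨f, hf, h, hh, rfl⟩ := this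
    exact ⟨f, hf, by simpa using hh⟩
  · rintro ⟨F, hF⟩
    refine ⟨F, fun x hx => ?_⟩
    obtain ⟨f, hf, h⟩ := hF x hx
    simp only [Set.mem_iUnion]
    exact ⟨f, hf, x * f⁻¹, h, by simp⟩

lemma HFin.mono {H : Subgroup G} {X Y : Set G} (h : HFin H Y) (hs : X ⊆ Y) : HFin H X := by
  obtain ⟨F, hF⟩ := h
  exact ⟨F, hs.trans hF⟩

lemma hfin_empty (H : Subgroup G) : HFin H (∅ : Set G) := ⟨∅, by simp⟩

lemma HFin.union {H : Subgroup G} {X Y : Set G} (h : HFin H X) (h' : HFin H Y) :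
    HFin H (X ∪ Y) := by
  classical
  rw [hfin_iff] at *
  obtain ⟨F, hF⟩ := h
  obtain ⟨F', hF'⟩ := h'
  refine ⟨F ∪ F', ?_⟩
  rintro x (hx | hx)
  · obtain ⟨f, hf, h⟩ := hF x hx
    exact ⟨f, Finset.mem_union_left _ hf, h⟩
  · obtain ⟨f, hf, h⟩ := hF' x hx
    exact ⟨f, Finset.mem_union_right _ hf, h⟩

lemma hfin_biUnion {ι : Type*} {H : Subgroup G} {s : Set ι} (hs : s.Finite) (A : ι → Set G)
    (h : ∀ i ∈ s, HFin H (A i)) : HFin H (⋃ i ∈ s, A i) := by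
  classical
  induction s, hs using Set.Finite.induction_on with
  | empty => simpa using hfin_empty H
  | insert _ _ ih =>
    rw [Set.biUnion_insert]
    exact (h _ (Set.mem_insert _ _)).union (ih fun i hi => h i (Set.mem_insert_of_mem _ hi))

lemma HFin.trans {H K : Subgroup G} {X : Set G} (h : HFin H (K : Set G)) (h' : HFin K X) :
    HFin H X := by
  classical
  rw [hfin_iff] at *
  obtain ⟨F, hF⟩ := h
  obtain ⟨F', hF'⟩ := h'
  refine ⟨F * F', fun x hx => ?_⟩
  obtain ⟨f, hf, h⟩ := hF' x hx
  obtain ⟨f', hf', h'⟩ := hF _ h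
  exact ⟨f' * f, Finset.mul_mem_mul hf' hf, by simpa [mul_assoc] using h'⟩

lemma HFin.of_le {H K : Subgroup G} (h : K ≤ H) : HFin H (K : Set G) := by
  rw [hfin_iff]
  exact ⟨{1}, fun x hx => ⟨1, by simp, by simpa using h hx⟩⟩

lemma HFin.preim {H : Subgroup G} {X : Set G} (h : HFin H X) (s : G) :
    HFin H {g | g * s ∈ X} := by
  classical
  rw [hfin_iff] at *
  obtain ⟨F, hF⟩ := h
  refine ⟨F.image (· * s⁻¹), fun x hx => ?_⟩
  obtain ⟨f, hf, h⟩ := hF _ hx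
  exact ⟨f * s⁻¹, Finset.mem_image_of_mem _ hf, by simpa [mul_assoc] using h⟩

lemma HFin.sat {H : Subgroup G} {X : Set G} (h : HFin H X) :
    HFin H {g | ∃ k ∈ H, k * g ∈ X} := by
  rw [hfin_iff] at *
  obtain ⟨F, hF⟩ := h
  refine ⟨F, ?_⟩
  rintro x ⟨k, hk, hx⟩
  obtain ⟨f, hf, h⟩ := hF _ hx
  refine ⟨f, hf, ?_⟩
  rw [mul_assoc] at h
  exact (H.mul_mem_cancel_left hk).1 h

lemma hfin_of_relIndex {H K : Subgroup G} (h : H.relIndex K ≠ 0) : HFin H (K : Set G) := by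
  classical
  rw [hfin_iff]
  have : (H.subgroupOf K).FiniteIndex := ⟨h⟩
  have : Finite (K ⧸ H.subgroupOf K) := inferInstance
  have := Fintype.ofFinite (K ⧸ H.subgroupOf K)
  refine ⟨(Finset.univ : Finset (K ⧸ H.subgroupOf K)).image
    (fun q => ((Quotient.out q : K) : G)⁻¹), fun x hx => ?_⟩
  refine ⟨_, Finset.mem_image_of_mem _ (Finset.mem_univ
    (QuotientGroup.mk (⟨x, hx⟩⁻¹ : K) : K ⧸ H.subgroupOf K)), ?_⟩
  have h1 := QuotientGroup.out_eq' (QuotientGroup.mk (⟨x, hx⟩⁻¹ : K) : K ⧸ H.subgroupOf K)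
  have h2 := (QuotientGroup.eq.1 h1.symm)
  rw [Subgroup.mem_subgroupOf] at h2
  simpa using h2

/-- Left invariance. -/
def LInv (H : Subgroup G) (X : Set G) : Prop := ∀ h ∈ H, ∀ x, h * x ∈ X ↔ x ∈ X

/-- Right almost invariance. -/
def RAI (H : Subgroup G) (X : Set G) : Prop := ∀ s : G, HFin H {g | g ∈ X ∧ g * s ∉ X}

lemma isAI_iff (H : Subgroup G) (X : Set G) : IsAI H X ↔ LInv H X ∧ RAI H X := by
  constructor
  · rintro ⟨h1, h2⟩
    refine ⟨fun h hh x => ?_, fun s => (h2 s⁻¹).mono ?_⟩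
    · conv_lhs => rw [← h1 h hh]
      simp
    · rintro g ⟨hg, hgs⟩
      refine Or.inr ⟨hg, ?_⟩
      rintro ⟨y, hy, rfl⟩
      simp at hgs
      exact hgs hy
  · rintro ⟨h1, h2⟩
    refine ⟨fun h hh => ?_, fun s => ?_⟩
    · ext x
      constructor
      · rintro ⟨y, hy, rfl⟩
        exact (h1 h hh y).2 hy
      · intro hx
        exact ⟨h⁻¹ * x, (h1 _ (H.inv_mem hh) x).2 hx, by simp⟩
    · refine (((h2 s).preim s⁻¹).union (h2 s⁻¹)).mono ?_
      rintro g (⟨⟨y, hy, rfl⟩, hg⟩ | ⟨hg, hg'⟩)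
      · left
        simpa using ⟨hy, hg⟩
      · right
        refine ⟨hg, fun h => hg' ⟨_, h, by simp⟩⟩

lemma LInv.compl {H : Subgroup G} {X : Set G} (h : LInv H X) : LInv H Xᶜ :=
  fun k hk x => not_congr (h k hk x)

lemma RAI.compl {H : Subgroup G} {X : Set G} (h : RAI H X) : RAI H Xᶜ := by
  intro s
  refine ((h s⁻¹).preim s).mono ?_
  rintro g ⟨hg, hgs⟩
  simp only [Set.mem_compl_iff, not_not] at hg hgs
  simpa using ⟨hgs, hg⟩

lemma NontrivAI.compl {H : Subgroup G} {X : Set G} (h : NontrivAI H X) : NontrivAI H Xᶜ := by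
  obtain ⟨h1, h2, h3⟩ := h
  rw [isAI_iff] at h1
  exact ⟨(isAI_iff _ _).2 ⟨h1.1.compl, h1.2.compl⟩, h3, by simpa using h2⟩

lemma RAI.equiv {H : Subgroup G} {X Z : Set G} (h : RAI H X) (hs : HFin H (X ∆ Z)) :
    RAI H Z := by
  intro s
  refine (((h s).union hs).union (hs.preim s)).mono ?_
  rintro g ⟨hg, hgs⟩
  by_cases h1 : g ∈ X
  · by_cases h2 : g * s ∈ X
    · right; left; exact ⟨h2, hgs⟩
    · left; left; exact ⟨h1, h2⟩
  · left; right; right; exact ⟨hg, h1⟩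

lemma RAI.of_trans {H K : Subgroup G} {X : Set G} (h : RAI K X) (hs : HFin H (K : Set G)) :
    RAI H X := fun s => hs.trans (h s)

/-- If `Z` separates the translates of `a`, `b` under `K`, and is almost invariant over `H`, then
`K` is `H`-finite. -/
lemma hfin_of_sep {H K : Subgroup G} {Z : Set G} {a b : G} (hZ : RAI H Z)
    (h : ∀ k ∈ K, k * a ∈ Z ∧ k * b ∉ Z) : HFin H (K : Set G) := by
  refine ((hZ (a⁻¹ * b)).preim a).mono ?_
  intro k hk
  refine ⟨(h k hk).1, ?_⟩
  have := (h k hk).2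
  simpa [mul_assoc] using this

lemma nonempty_of_not_hfin {H : Subgroup G} {X : Set G} (h : ¬ HFin H X) : X.Nonempty := by
  by_contra h'
  rw [Set.not_nonempty_iff_eq_empty] at h'
  exact h (h' ▸ hfin_empty H)

lemma exists_diff {H : Subgroup G} {X N : Set G} (h : ¬ HFin H X) (hN : HFin H N) :
    ∃ a ∈ X, a ∉ N := by
  by_contra h'
  push Not at h'
  exact h (hN.mono h')

lemma comm1 {H K : Subgroup G} {X Z : Set G} (hX : RAI H X) (hXZ : HFin H (X ∆ Z))
    (hZ : NontrivAI K Z) : HFin H (K : Set G) := by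
  obtain ⟨h1, h2, h3⟩ := hZ
  rw [isAI_iff] at h1
  obtain ⟨a, ha⟩ := nonempty_of_not_hfin h2
  obtain ⟨b, hb⟩ := nonempty_of_not_hfin h3
  exact hfin_of_sep (a := a) (b := b) (hX.equiv hXZ) fun k hk =>
    ⟨(h1.1 k hk a).2 ha, fun h => hb ((h1.1 k hk b).1 h)⟩

lemma comm2 {H K : Subgroup G} {X Z : Set G} (hX : LInv H X) (hn : ¬ HFin H X)
    (hn' : ¬ HFin H Xᶜ) (hXZ : HFin H (X ∆ Z)) (hZ : RAI K Z) : HFin K (H : Set G) := by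
  obtain ⟨a, ha, ha'⟩ := exists_diff hn hXZ.sat
  obtain ⟨b, hb, hb'⟩ := exists_diff hn' hXZ.sat
  refine hfin_of_sep (a := a) (b := b) hZ fun k hk => ⟨?_, ?_⟩
  · by_contra h
    exact ha' ⟨k, hk, Or.inl ⟨(hX k hk a).2 ha, h⟩⟩
  · intro h
    exact hb' ⟨k, hk, Or.inr ⟨h, fun h' => hb ((hX k hk b).1 h')⟩⟩

lemma comm12 {H K : Subgroup G} {X Z : Set G} (hX : NontrivAI H X) (hZ : NontrivAI K Z)
    (hXZ : HFin H (X ∆ Z) ∨ HFin H (X ∆ Zᶜ)) : HFin H (K : Set G) ∧ HFin K (H : Set G) := by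
  have key : ∀ Z' : Set G, NontrivAI K Z' → HFin H (X ∆ Z') →
      HFin H (K : Set G) ∧ HFin K (H : Set G) := by
    intro Z' hZ' h
    have h1 := (isAI_iff _ _).1 hX.1
    have h2 := (isAI_iff _ _).1 hZ'.1
    exact ⟨comm1 h1.2 h hZ', comm2 h1.1 hX.2.1 hX.2.2 h h2.2⟩
  rcases hXZ with h | h
  · exact key _ hZ h
  · exact key _ hZ.compl h

lemma corner_symm {H K : Subgroup G} {X Z : Set G} (hX : LInv H X) (hn : ¬ HFin H X)
    (hZ : RAI K Z) (h : HFin H (X ∩ Z)) : HFin K (X ∩ Z) := by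
  obtain ⟨F, hF⟩ := (hfin_iff _ _).1 h
  obtain ⟨a, ha, ha'⟩ := exists_diff hn h.sat
  refine (hfin_biUnion F.finite_toSet (fun f => {g | g ∈ Z ∧ g * (f⁻¹ * a) ∉ Z})
    (fun f _ => hZ _)).mono ?_
  rintro x ⟨hx, hxz⟩
  obtain ⟨f, hf, hh⟩ := hF x ⟨hx, hxz⟩
  simp only [Set.mem_iUnion]
  refine ⟨f, hf, hxz, fun h' => ?_⟩
  rw [← mul_assoc] at h'
  exact ha' ⟨_, hh, (hX _ hh a).2 ha, h'⟩

lemma crosses_symm {H K : Subgroup G} {X Z : Set G} (hX : NontrivAI H X) (hZ : NontrivAI K Z)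
    (h : Crosses H X Z) : Crosses K Z X := by
  have key : ∀ X' Z' : Set G, NontrivAI H X' → NontrivAI K Z' → ¬ HFin H (X' ∩ Z') →
      ¬ HFin K (Z' ∩ X') := by
    intro X' Z' hX' hZ' hn hf
    apply hn
    rw [Set.inter_comm]
    exact corner_symm ((isAI_iff _ _).1 hZ'.1).1 hZ'.2.1 ((isAI_iff _ _).1 hX'.1).2 hf
  obtain ⟨a, b, c, d⟩ := h
  exact ⟨key _ _ hX hZ a, key _ _ hX.compl hZ c, key _ _ hX hZ.compl b,
    key _ _ hX.compl hZ.compl d⟩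

lemma crosses_compl {H : Subgroup G} {X Z : Set G} (h : Crosses H Xᶜ Z) : Crosses H X Z := by
  obtain ⟨a, b, c, d⟩ := h
  rw [compl_compl] at c d
  exact ⟨c, d, a, b⟩

lemma crosses_trans {H K : Subgroup G} {X Z : Set G} (h : Crosses K X Z)
    (hK : HFin K (H : Set G)) : Crosses H X Z := by
  obtain ⟨a, b, c, d⟩ := h
  exact ⟨fun h => a (hK.trans h), fun h => b (hK.trans h), fun h => c (hK.trans h),
    fun h => d (hK.trans h)⟩

lemma crosses_equiv {H : Subgroup G} {X X' Z : Set G} (h : Crosses H X' Z)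
    (hs : HFin H (X ∆ X')) : Crosses H X Z := by
  obtain ⟨a, b, c, d⟩ := h
  refine ⟨fun h => a ((h.union hs).mono ?_), fun h => b ((h.union hs).mono ?_),
    fun h => c ((h.union hs).mono ?_), fun h => d ((h.union hs).mono ?_)⟩ <;>
  · rintro x ⟨h1, h2⟩
    by_cases hx : x ∈ X
    · first
      | exact Or.inl ⟨hx, h2⟩
      | exact Or.inr (Or.inl ⟨hx, h1⟩)
    · first
      | exact Or.inl ⟨hx, h2⟩
      | exact Or.inr (Or.inr ⟨h1, hx⟩)

/-- If `J` has infinite index then a `J`-finite `K`-almost invariant set is `K`-finite. -/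
lemma neumann {J K : Subgroup G} {Z : Set G} (hJ : ¬ HFin J (Set.univ : Set G))
    (hZ : RAI K Z) (h : HFin J Z) : HFin K Z := by
  classical
  obtain ⟨F, hF⟩ := (hfin_iff _ _).1 h
  have : ∃ s : G, ∀ f ∈ F, ∀ f' ∈ F, f * s * f'⁻¹ ∉ J := by
    by_contra hcon
    push Not at hcon
    have hcov : ⋃ i ∈ F ×ˢ F, (i.1⁻¹ * i.2) •
        ((J.comap (MulAut.conj i.2).toMonoidHom : Subgroup G) : Set G) = Set.univ := by
      refine Set.eq_univ_of_forall fun s => ?_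
      obtain ⟨f, hf, f', hf', hs⟩ := hcon s
      simp only [Set.mem_iUnion]
      refine ⟨(f, f'), Finset.mk_mem_product hf hf', ?_⟩
      rw [Set.mem_smul_set_iff_inv_smul_mem]
      simp only [Subgroup.coe_comap, Set.mem_preimage, SetLike.mem_coe]
      simpa [mul_assoc] using hs
    obtain ⟨k, -, hk⟩ := Subgroup.exists_finiteIndex_of_leftCoset_cover hcov
    apply hJ
    have h1 : (J.comap (MulAut.conj k.2).toMonoidHom).index = J.index :=
      Subgroup.index_comap_of_surjective _ (MulAut.conj k.2).surjective
    have h2 : J.relIndex ⊤ ≠ 0 := by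
      rw [Subgroup.relIndex_top_right, ← h1]; exact hk.index_ne_zero
    simpa using hfin_of_relIndex h2
  obtain ⟨s, hs⟩ := this
  refine (hZ s).mono fun z hz => ⟨hz, fun hzs => ?_⟩
  obtain ⟨f, hf, h1⟩ := hF _ hz
  obtain ⟨f', hf', h2⟩ := hF _ hzs
  apply hs f hf f' hf'
  have := J.mul_mem (J.inv_mem h1) h2
  simpa [mul_assoc] using this

end GroupLemmas

section TreeLemmas
variable {G V : Type*} [Group G] [MulAction G V] {T : SimpleGraph V}

lemma cross_walk {S : Set V} {a b : V} (p : T.Walk a b) (ha : a ∈ S) (hb : b ∉ S) :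
    ∃ e ∈ p.edges, e ∈ cobdry T S := by
  induction p with
  | nil => exact absurd ha hb
  | @cons a c b h p ih =>
    by_cases hc : c ∈ S
    · obtain ⟨e, he, h'⟩ := ih hc hb
      exact ⟨e, by simp [he], h'⟩
    · exact ⟨s(a, c), by simp, h, a, c, rfl, ha, hc⟩

lemma cobdry_compl (S : Set V) : cobdry T Sᶜ = cobdry T S := by
  ext e
  constructor
  · rintro ⟨h, u, v, rfl, hu, hv⟩
    exact ⟨h, v, u, Sym2.eq_swap, by simpa using hv, hu⟩
  · rintro ⟨h, u, v, rfl, hu, hv⟩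
    exact ⟨h, v, u, Sym2.eq_swap, hv, by simpa using hu⟩

lemma cobdry_inter (S S' : Set V) : cobdry T (S ∩ S') ⊆ cobdry T S ∪ cobdry T S' := by
  rintro e ⟨h, u, v, rfl, hu, hv⟩
  by_cases h' : v ∈ S
  · exact Or.inr ⟨h, u, v, rfl, hu.2, fun h'' => hv ⟨h', h''⟩⟩
  · exact Or.inl ⟨h, u, v, rfl, hu.1, h'⟩

lemma cross_walk' {S : Set V} {a b : V} (p : T.Walk a b) (h : ¬ (a ∈ S ↔ b ∈ S)) :
    ∃ e ∈ p.edges, e ∈ cobdry T S := by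
  by_cases ha : a ∈ S
  · exact cross_walk p ha (fun hb => h (by tauto))
  · rw [← cobdry_compl]
    exact cross_walk p ha (by simp only [Set.mem_compl_iff]; tauto)

lemma mem_of_adj_not_cobdry {S : Set V} {a b : V} (h : T.Adj a b) (hn : s(a, b) ∉ cobdry T S) :
    a ∈ S ↔ b ∈ S := by
  constructor
  · intro ha
    by_contra hb
    exact hn ⟨h, a, b, rfl, ha, hb⟩
  · intro hb
    by_contra ha
    exact hn ⟨h, b, a, Sym2.eq_swap, hb, ha⟩

/-- The translation by `g` as a graph homomorphism. -/
def trHom (hact : ActsOn T G) (g : G) : T →g T := ⟨(g • ·), fun h => hact g _ _ h⟩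

lemma edgeStab_fix (hinv : NoInversions T G) {e : Sym2 V} (he : e ∈ T.edgeSet) {g : G}
    (hg : g ∈ edgeStab G e) {x : V} (hx : x ∈ e) : g • x = x := by
  induction e using Sym2.ind with
  | _ a b =>
    have h : Sym2.map (g • ·) s(a, b) = s(a, b) := hg
    rw [Sym2.map_mk, Sym2.eq_iff] at h
    rcases h with ⟨h1, h2⟩ | ⟨h1, h2⟩
    · rcases Sym2.mem_iff.1 hx with rfl | rfl <;> assumption
    · exact absurd ⟨h1, h2⟩ (hinv g a b he)

lemma path_fix (hT : T.IsTree) (hact : ActsOn T G) {x y : V} {p : T.Walk x y} (hp : p.IsPath)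
    {g : G} (hx : g • x = x) (hy : g • y = y) : ∀ w ∈ p.support, g • w = w := by
  have hinj : Function.Injective (trHom hact g) := MulAction.injective g
  have hq : (p.map (trHom hact g)).IsPath := SimpleGraph.Walk.IsPath.map hinj hp
  have hx' : trHom hact g x = x := hx
  have hy' : trHom hact g y = y := hy
  have hq2 : ((p.map (trHom hact g)).copy hx' hy').IsPath := by simpa using hq
  have := congrArg Subtype.val ((hT.isAcyclic.subsingleton_path _ _).elim ⟨_, hq2⟩ ⟨_, hp⟩)
  have h2 := congrArg SimpleGraph.Walk.support this
  simp only [SimpleGraph.Walk.support_copy, SimpleGraph.Walk.support_map] at h2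
  conv_rhs at h2 => rw [← List.map_id p.support]
  exact fun w hw => List.map_inj_left.1 h2 w hw

lemma raiXS (hT : T.IsTree) (hact : ActsOn T G) (v₀ : V) {S : Set V} {H : Subgroup G}
    (hfin : (cobdry T S).Finite) (h : ∀ f ∈ cobdry T S, HFin H (edgeStab G f : Set G)) :
    RAI H (XS G v₀ S) := by
  intro s
  obtain ⟨p⟩ := hT.connected.preconnected v₀ (s • v₀)
  refine (hfin_biUnion hfin (fun f => ⋃ f₀ ∈ {e | e ∈ p.edges},
    {g : G | Sym2.map (g • ·) f₀ = f}) ?_).mono ?_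
  · intro f hf
    refine hfin_biUnion (List.finite_toSet _) _ fun f₀ _ => ?_
    refine (h f hf).trans ?_
    by_cases hne : ∃ g₁ : G, Sym2.map (g₁ • ·) f₀ = f
    · obtain ⟨g₁, hg₁⟩ := hne
      rw [hfin_iff]
      refine ⟨{g₁}, fun g hg => ⟨g₁, by simp, ?_⟩⟩
      change Sym2.map ((g * g₁⁻¹) • ·) f = f
      conv_rhs => rw [← (show Sym2.map (g • ·) f₀ = f from hg)]
      conv_lhs => rw [← hg₁]
      rw [Sym2.map_map]
      congr 1
      funext w
      simp [mul_smul]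
    · refine (hfin_empty _).mono fun g hg => hne ⟨g, hg⟩
  · rintro g ⟨hg, hgs⟩
    have hgs' : g • (s • v₀) ∉ S := by rw [← mul_smul]; exact hgs
    obtain ⟨e, he, he'⟩ := cross_walk (p.map (trHom hact g)) hg hgs'
    rw [SimpleGraph.Walk.edges_map, List.mem_map] at he
    obtain ⟨f₀, hf₀, rfl⟩ := he
    simp only [Set.mem_iUnion]
    exact ⟨_, he', f₀, hf₀, rfl⟩

lemma linvXS (hT : T.IsTree) (hact : ActsOn T G) (hinv : NoInversions T G) (v₀ : V) {S : Set V}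
    {H : Subgroup G} {x : V} (hx : ∀ h ∈ H, h • x = x)
    (h : ∀ f ∈ cobdry T S, H ≤ edgeStab G f) :
    LInv H (XS G v₀ S) := by
  have key : ∀ g ∈ H, ∀ y w : V, T.Walk y w → g • y = y → (w ∈ S ↔ g • w ∈ S) := by
    intro g hg y w p hy
    have : ∀ a b : V, ∀ p : T.Walk a b, (a ∈ S ↔ g • a ∈ S) → (b ∈ S ↔ g • b ∈ S) := by
      intro a b p
      induction p with
      | nil => exact id
      | @cons a c b hac p ih =>
        intro ha
        apply ih
        by_cases hcb : s(a, c) ∈ cobdry T S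
        · rw [edgeStab_fix hinv hac (h _ hcb hg) (Sym2.mem_mk_right a c)]
        · have h1 := mem_of_adj_not_cobdry hac hcb
          have h2 := mem_of_adj_not_cobdry (S := S) (hact g _ _ hac) (by
            intro hcb'
            apply hcb
            have h3 := h _ hcb' (H.inv_mem hg)
            have h4 : Sym2.map (g⁻¹ • ·) s(g • a, g • c) = s(g • a, g • c) := h3
            rw [Sym2.map_mk, inv_smul_smul, inv_smul_smul] at h4
            rwa [h4])
          tauto
    exact this y w p (by rw [hy])
  intro g hg k
  obtain ⟨p⟩ := hT.connected.preconnected x (k • v₀)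
  have := key g hg _ _ p (hx g hg)
  change (g * k) • v₀ ∈ S ↔ k • v₀ ∈ S
  rw [mul_smul]
  exact this.symm

/-- Cylinders are convex. -/
lemma cyl_convex (hT : T.IsTree) (hact : ActsOn T G) (hinv : NoInversions T G)
    {E : Set (Subgroup G)} (hE : Admissible E) (hET : IsETree T G E)
    {Y : Set (Sym2 V)} (hY : IsCylinder T G Y) {f f' e : Sym2 V} (hf : f ∈ Y) (hf' : f' ∈ Y)
    {x y : V} (hx : x ∈ f) (hy : y ∈ f') {p : T.Walk x y} (hp : p.IsPath) (he : e ∈ p.edges) :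
    e ∈ Y := by
  obtain ⟨-, hYs, hYc⟩ := hY
  have heT := p.edges_subset_edgeSet he
  rw [hYc f hf e heT]
  have hc := (hYc f hf f' (hYs hf')).1 hf'
  have hle : edgeStab G f ⊓ edgeStab G f' ≤ edgeStab G e := by
    intro g hg
    have h1 := edgeStab_fix hinv (hYs hf) hg.1 hx
    have h2 := edgeStab_fix hinv (hYs hf') hg.2 hy
    have h3 := path_fix hT hact hp h1 h2
    induction e using Sym2.ind with
    | _ a b =>
      change Sym2.map (g • ·) s(a, b) = s(a, b)
      rw [Sym2.map_mk, h3 a (p.fst_mem_support_of_mem_edges he),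
        h3 b (p.snd_mem_support_of_mem_edges he)]
  have hcf : Subgroup.Commensurable (edgeStab G f ⊓ edgeStab G f') (edgeStab G f) := by
    constructor
    · rw [Subgroup.inf_relIndex_left]
      exact hc.2
    · rw [Subgroup.relIndex_eq_one.2 inf_le_left]; exact one_ne_zero
  have hmem := hE.2.1 _ (hET f (hYs hf)) _ hcf
  have hce : Subgroup.Commensurable (edgeStab G f ⊓ edgeStab G f') (edgeStab G e) :=
    ⟨hE.2.2 _ hmem _ (hET e heT) hle, by rw [Subgroup.relIndex_eq_one.2 hle]; exact one_ne_zero⟩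
  exact hcf.symm.trans hce

lemma bridge (hT : T.IsTree) {u v : V} (h : T.Adj u v) (p : T.Walk u v) : s(u, v) ∈ p.edges :=
  SimpleGraph.isBridge_iff_forall_walk_mem_edges.1
    (SimpleGraph.isAcyclic_iff_forall_isBridge.1 hT.isAcyclic h) p

lemma mem_halfTree_iff {u v w : V} :
    w ∈ halfTree T u v ↔ ∃ p : T.Walk v w, s(u, v) ∉ p.edges := by
  classical
  constructor
  · rintro ⟨p, -, h⟩; exact ⟨p, h⟩
  · rintro ⟨p, h⟩
    exact ⟨p.bypass, p.bypass_isPath, fun h' => h (p.edges_bypass_subset_edges h')⟩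

lemma mem_periForest_iff {Y : Set (Sym2 V)} {v w : V} :
    w ∈ periForest T Y v ↔ ∃ p : T.Walk v w, ∀ e ∈ Y, v ∈ e → e ∉ p.edges := by
  classical
  constructor
  · rintro ⟨p, -, h⟩; exact ⟨p, h⟩
  · rintro ⟨p, h⟩
    exact ⟨p.bypass, p.bypass_isPath, fun e h1 h2 h' => h e h1 h2 (p.edges_bypass_subset_edges h')⟩

lemma cobdry_halfTree {u v : V} : cobdry T (halfTree T u v) ⊆ {s(u, v)} := by
  rintro e ⟨h, a, b, rfl, ha, hb⟩
  replace h : T.Adj a b := h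
  obtain ⟨p, hp⟩ := mem_halfTree_iff.1 ha
  by_contra hne
  apply hb
  rw [mem_halfTree_iff]
  refine ⟨p.concat h, ?_⟩
  rw [SimpleGraph.Walk.edges_concat]
  simp only [List.concat_eq_append, List.mem_append, List.mem_singleton]
  rintro (h' | h')
  · exact hp h'
  · exact hne h'.symm

lemma cobdry_periForest {Y : Set (Sym2 V)} {v : V} :
    cobdry T (periForest T Y v) ⊆ {e | e ∈ Y ∧ v ∈ e} := by
  rintro e ⟨h, a, b, rfl, ha, hb⟩
  replace h : T.Adj a b := h
  obtain ⟨p, hp⟩ := mem_periForest_iff.1 ha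
  by_contra hne
  apply hb
  rw [mem_periForest_iff]
  refine ⟨p.concat h, fun e h1 h2 => ?_⟩
  rw [SimpleGraph.Walk.edges_concat]
  simp only [List.concat_eq_append, List.mem_append, List.mem_singleton]
  rintro (h' | h')
  · exact hp e h1 h2 h'
  · subst h'
    exact hne ⟨h1, h2⟩

lemma self_mem_halfTree (u v : V) : v ∈ halfTree T u v := ⟨.nil, by simp, by simp⟩

lemma self_mem_periForest (Y : Set (Sym2 V)) (v : V) : v ∈ periForest T Y v :=
  ⟨.nil, by simp, by simp⟩

lemma not_mem_halfTree (hT : T.IsTree) {u v : V} (h : T.Adj u v) : u ∉ halfTree T u v := by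
  rw [mem_halfTree_iff]
  rintro ⟨p, hp⟩
  apply hp
  have := bridge hT h.symm p
  rwa [Sym2.eq_swap]

lemma not_mem_periForest (hT : T.IsTree) {Y : Set (Sym2 V)} {u v : V} (h : T.Adj v u)
    (hY : s(v, u) ∈ Y) : u ∉ periForest T Y v := by
  rw [mem_periForest_iff]
  rintro ⟨p, hp⟩
  exact hp _ hY (Sym2.mem_mk_left _ _) (bridge hT h p)

/-- A path from `v` to a point outside of the peripheral forest: every edge has an endpoint outside
of the forest. -/
lemma path_out (hT : T.IsTree) {Y : Set (Sym2 V)} {v c : V} (hc : c ∉ periForest T Y v)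
    {p : T.Walk v c} (hp : p.IsPath) {f : Sym2 V} (hf : f ∈ p.edges) :
    ∃ y ∈ f, y ∉ periForest T Y v := by
  classical
  cases p with
  | nil => simp at hf
  | @cons _ u _ h p =>
    rw [SimpleGraph.Walk.cons_isPath_iff] at hp
    have hnv : ∀ e ∈ p.edges, v ∉ e := by
      intro e he hve
      exact hp.2 (p.mem_support_of_mem_edges he hve)
    have hY : s(v, u) ∈ Y := by
      by_contra hY
      apply hc
      rw [mem_periForest_iff]
      refine ⟨.cons h p, fun e h1 h2 h3 => ?_⟩
      rw [SimpleGraph.Walk.edges_cons, List.mem_cons] at h3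
      rcases h3 with rfl | h3
      · exact hY h1
      · exact hnv e h3 h2
    have hu := not_mem_periForest hT h hY
    rw [SimpleGraph.Walk.edges_cons, List.mem_cons] at hf
    rcases hf with rfl | hf
    · exact ⟨u, Sym2.mem_mk_right _ _, hu⟩
    · induction f using Sym2.ind with
      | _ a b =>
        refine ⟨a, Sym2.mem_mk_left _ _, fun ha => ?_⟩
        have hs := p.fst_mem_support_of_mem_edges hf
        obtain ⟨e, he, he'⟩ := cross_walk (p.takeUntil a hs).reverse ha hu
        rw [SimpleGraph.Walk.edges_reverse, List.mem_reverse] at he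
        exact hnv e (p.edges_takeUntil_subset_edges hs he) (cobdry_periForest he').2

lemma forest_nested (hT : T.IsTree) (hact : ActsOn T G) (hinv : NoInversions T G)
    {E : Set (Subgroup G)} (hE : Admissible E) (hET : IsETree T G E)
    {Y : Set (Sym2 V)} (hY : IsCylinder T G Y) (v : V)
    {S : Set V} {Y' : Set (Sym2 V)} (hY' : IsCylinder T G Y') (hS : cobdry T S ⊆ Y') :
    periForest T Y v ∩ S = ∅ ∨ periForest T Y v ∩ Sᶜ = ∅ ∨
      (periForest T Y v)ᶜ ∩ S = ∅ ∨ (periForest T Y v)ᶜ ∩ Sᶜ = ∅ := by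
  classical
  by_contra hcon
  push Not at hcon
  obtain ⟨⟨a, ha, haS⟩, ⟨b, hb, hbS⟩, ⟨c, hc, hcS⟩, ⟨d, hd, hdS⟩⟩ := hcon
  set R := periForest T Y v with hR
  have h1 : ∃ f ∈ cobdry T S, ∀ x ∈ f, x ∈ R := by
    have aux : ∀ w ∈ R, ¬ (v ∈ S ↔ w ∈ S) → ∃ f ∈ cobdry T S, ∀ x ∈ f, x ∈ R := by
      intro w hw hne
      obtain ⟨p, hp⟩ := mem_periForest_iff.1 hw
      obtain ⟨f, hf, hf'⟩ := cross_walk' p hne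
      refine ⟨f, hf', fun x hx => ?_⟩
      have hxs := p.mem_support_of_mem_edges hf hx
      exact mem_periForest_iff.2 ⟨p.takeUntil x hxs, fun e h1 h2 h3 =>
        hp e h1 h2 (p.edges_takeUntil_subset_edges hxs h3)⟩
    by_cases hvS : v ∈ S
    · exact aux b hb (by simp only [Set.mem_compl_iff] at hbS; tauto)
    · exact aux a ha (by tauto)
  have h2 : ∃ f ∈ cobdry T S, ∃ x ∈ f, x ∉ R := by
    have aux : ∀ w ∉ R, ¬ (v ∈ S ↔ w ∈ S) → ∃ f ∈ cobdry T S, ∃ x ∈ f, x ∉ R := by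
      intro w hw hne
      obtain ⟨p, hp, -⟩ := hT.existsUnique_path v w
      obtain ⟨f, hf, hf'⟩ := cross_walk' p hne
      exact ⟨f, hf', path_out hT hw hp hf⟩
    by_cases hvS : v ∈ S
    · exact aux d hd (by simp only [Set.mem_compl_iff] at hdS; tauto)
    · exact aux c hc (by tauto)
  obtain ⟨f, hf, hfR⟩ := h1
  obtain ⟨f', hf', y, hy, hyR⟩ := h2
  obtain ⟨x₀, hx₀⟩ : ∃ x, x ∈ f := by
    induction f using Sym2.ind with
    | _ a b => exact ⟨a, Sym2.mem_mk_left _ _⟩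
  obtain ⟨p, hp, -⟩ := hT.existsUnique_path x₀ y
  obtain ⟨e, he, he'⟩ := cross_walk p (hfR _ hx₀) hyR
  have heY' := cyl_convex hT hact hinv hE hET hY' (hS hf) (hS hf') hx₀ hy hp he
  obtain ⟨heY, hve⟩ := cobdry_periForest he'
  have hfY : f ∈ Y := by
    rw [hY.2.2 e heY f (hY'.2.1 (hS hf)), ← hY'.2.2 e heY' f (hY'.2.1 (hS hf))]
    exact hS hf
  obtain ⟨x, hx, hxv⟩ : ∃ x ∈ f, x ≠ v := by
    have hfT := hY.2.1 hfY
    induction f using Sym2.ind with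
    | _ a b =>
      have hne : a ≠ b := (show T.Adj a b from hfT).ne
      by_cases hav : a = v
      · exact ⟨b, Sym2.mem_mk_right _ _, fun h => hne (hav.trans h.symm)⟩
      · exact ⟨a, Sym2.mem_mk_left _ _, hav⟩
  obtain ⟨q, hq, hqY⟩ := hfR x hx
  cases q with
  | nil => exact hxv rfl
  | @cons _ z _ h q =>
    have hz : s(v, z) ∈ (SimpleGraph.Walk.cons h q).edges := by simp
    exact hqY _ (cyl_convex hT hact hinv hE hET hY heY hfY hve hx hq hz)
      (Sym2.mem_mk_left _ _) hz

/-! Unboundedness of half-trees. -/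

lemma compl_half_convex {u v a b w : V} (ha : a ∉ halfTree T u v) (hb : b ∉ halfTree T u v)
    {p : T.Walk a b} (hp : p.IsPath) (hw : w ∈ p.support) : w ∉ halfTree T u v := by
  classical
  intro hwH
  obtain ⟨e, he, he'⟩ := cross_walk (p.takeUntil w hw).reverse hwH ha
  obtain ⟨f, hf, hf'⟩ := cross_walk (p.dropUntil w hw) hwH hb
  have h1 : e = s(u, v) := cobdry_halfTree he'
  have h2 : f = s(u, v) := cobdry_halfTree hf'
  rw [SimpleGraph.Walk.edges_reverse, List.mem_reverse] at he
  have hnd := hp.isTrail.edges_nodup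
  rw [← p.take_spec hw, SimpleGraph.Walk.edges_append, List.nodup_append] at hnd
  exact hnd.2.2 _ he _ hf (h1.trans h2.symm)

lemma half_orbit (hT : T.IsTree) (hact : ActsOn T G) (hmin : MinimalAction T G) (u v x : V) :
    ∃ g : G, g • x ∈ halfTree T u v := by
  by_contra hcon
  push Not at hcon
  have := hmin {w | ∀ g : G, g • w ∉ halfTree T u v} ⟨x, hcon⟩
    (fun g a ha k => by rw [← mul_smul]; exact ha _) (by
      intro a ha b hb w hw g
      obtain ⟨p, hp, -⟩ := hT.existsUnique_path a b
      have hq : (p.map (trHom hact g)).IsPath :=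
        SimpleGraph.Walk.IsPath.map (MulAction.injective g) hp
      refine compl_half_convex (ha g) (hb g) hq ?_
      have h1 : trHom hact g w ∈ (p.map (trHom hact g)).support := by
        rw [SimpleGraph.Walk.support_map]
        exact List.mem_map_of_mem (hw p hp)
      exact h1)
  have hv : v ∈ {w | ∀ g : G, g • w ∉ halfTree T u v} := by rw [this]; trivial
  have := hv 1
  rw [one_smul] at this
  exact this (self_mem_halfTree u v)

lemma no_leaf (hT : T.IsTree) (hact : ActsOn T G) (hinv : NoInversions T G)
    (hmin : MinimalAction T G) {u v : V} (h : T.Adj u v) : ∃ w, T.Adj v w ∧ w ≠ u := by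
  by_contra hcon
  push Not at hcon
  obtain ⟨g, p, hp, hpe⟩ := half_orbit hT hact hmin u v u
  have hgu : g • u = v := by
    generalize g • u = w at p
    cases p with
    | nil => rfl
    | cons h' q =>
      have := hcon _ h'
      subst this
      simp [Sym2.eq_swap] at hpe
  have h2 : T.Adj (g • u) (g • v) := hact g _ _ h
  rw [hgu] at h2
  exact hinv g u v h ⟨hgu, hcon _ h2⟩

lemma half_cons (hT : T.IsTree) {u v w : V} (h : T.Adj u v) (hw : w ∈ halfTree T u v) :
    ∃ p : T.Walk v w, p.IsPath ∧ u ∉ p.support := by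
  classical
  obtain ⟨p, hp, hpe⟩ := hw
  refine ⟨p, hp, fun hu => ?_⟩
  exact not_mem_halfTree hT h (mem_halfTree_iff.2 ⟨p.takeUntil u hu, fun h' =>
    hpe (p.edges_takeUntil_subset_edges hu h')⟩)

lemma dist_path (hT : T.IsTree) {u v : V} {p : T.Walk u v} (hp : p.IsPath) :
    T.dist u v = p.length := by
  obtain ⟨q, hq, hl⟩ := hT.connected.exists_path_of_dist u v
  rw [← hl, (hT.existsUnique_path u v).unique hq hp]

lemma half_dist (hT : T.IsTree) {u v w : V} (h : T.Adj u v) (hw : w ∈ halfTree T u v) :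
    T.dist u w = T.dist v w + 1 := by
  obtain ⟨p, hp, hu⟩ := half_cons hT h hw
  have hq : (SimpleGraph.Walk.cons h p).IsPath := (SimpleGraph.Walk.cons_isPath_iff _ _).2 ⟨hp, hu⟩
  rw [dist_path hT hp, dist_path hT hq]
  simp

lemma half_sub (hT : T.IsTree) {u v z w : V} (h' : T.Adj v z) (hz : z ≠ u)
    (hw : w ∈ halfTree T v z) : w ∈ halfTree T u v := by
  obtain ⟨p, hp, hv⟩ := half_cons hT h' hw
  refine mem_halfTree_iff.2 ⟨.cons h' p, ?_⟩
  rw [SimpleGraph.Walk.edges_cons, List.mem_cons]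
  rintro (h1 | h1)
  · rw [Sym2.eq_swap, Sym2.eq_iff] at h1
    rcases h1 with ⟨-, h1⟩ | ⟨h1, h2⟩
    · exact hz h1.symm
    · exact h'.ne h1
  · exact hv (p.snd_mem_support_of_mem_edges h1)

lemma half_deep (hT : T.IsTree) (hact : ActsOn T G) (hinv : NoInversions T G)
    (hmin : MinimalAction T G) (x : V) (n : ℕ) : ∀ {u v : V}, T.Adj u v →
    ∃ g : G, g • x ∈ halfTree T u v ∧ n ≤ T.dist u (g • x) := by
  induction n with
  | zero =>
    intro u v _
    obtain ⟨g, hg⟩ := half_orbit hT hact hmin u v x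
    exact ⟨g, hg, Nat.zero_le _⟩
  | succ n ih =>
    intro u v h
    obtain ⟨z, hz, hzu⟩ := no_leaf hT hact hinv hmin h
    obtain ⟨g, hg, hd⟩ := ih hz
    have hg' := half_sub hT hz hzu hg
    exact ⟨g, hg', by rw [half_dist hT h hg']; omega⟩

lemma dist_smul (hT : T.IsTree) (hact : ActsOn T G) (g : G) (a b : V) :
    T.dist (g • a) (g • b) = T.dist a b := by
  obtain ⟨p, hp, -⟩ := hT.existsUnique_path a b
  have hq : (p.map (trHom hact g)).IsPath :=
    SimpleGraph.Walk.IsPath.map (MulAction.injective g) hp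
  have h1 := dist_path hT hq
  rw [SimpleGraph.Walk.length_map, ← dist_path hT hp] at h1
  exact h1

lemma half_not_hfin (hT : T.IsTree) (hact : ActsOn T G) (hinv : NoInversions T G)
    (hmin : MinimalAction T G) (x : V) {u v : V} (h : T.Adj u v) {K : Subgroup G}
    (hK : ∀ k ∈ K, k • u = u) : ¬ HFin K (XS G x (halfTree T u v)) := by
  rw [hfin_iff]
  rintro ⟨F, hF⟩
  obtain ⟨g, hg, hd⟩ := half_deep hT hact hinv hmin x (F.sup (fun f => T.dist u (f • x)) + 1) h
  obtain ⟨f, hf, hk⟩ := hF g hg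
  have h1 := dist_smul hT hact (g * f⁻¹) u (f • x)
  rw [hK _ hk, ← mul_smul, inv_mul_cancel_right] at h1
  have h2 := Finset.le_sup (f := fun f : G => T.dist u (f • x)) hf
  omega

lemma hfin_iInf {Y : Set (Sym2 V)} (hY : IsCylinder T G Y) {F : Set (Sym2 V)} (hF : F.Finite)
    (hFY : F ⊆ Y) {e : Sym2 V} (he : e ∈ Y) :
    HFin (⨅ f ∈ F, edgeStab G f) (edgeStab G e : Set G) := by
  apply hfin_of_relIndex
  have : Finite F := hF
  rw [iInf_subtype']
  refine Subgroup.relIndex_iInf_ne_zero fun i => ?_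
  exact ((hY.2.2 e he _ (hY.2.1 (hFY i.2))).1 (hFY i.2)).2

lemma peri_nontriv (hT : T.IsTree) (hact : ActsOn T G) (hinv : NoInversions T G)
    (hmin : MinimalAction T G) (v₀ : V)
    (Y : Set (Sym2 V)) (hY : IsCylinder T G Y)
    (v : V) (hv : v ∈ cylBoundary T Y) (hval : FiniteValenceIn Y v) :
    NontrivAI (periStab G Y v) (XvY T G v₀ Y v) := by
  obtain ⟨⟨e, he, hve⟩, e', he', hve', he'Y⟩ := hv
  have hle : ∀ f ∈ {e : Sym2 V | e ∈ Y ∧ v ∈ e}, periStab G Y v ≤ edgeStab G f :=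
    fun f hf => iInf₂_le f hf
  have hfix : ∀ k ∈ periStab G Y v, k • v = v := fun k hk =>
    edgeStab_fix hinv (hY.2.1 he) (hle e ⟨he, hve⟩ hk) hve
  refine ⟨(isAI_iff _ _).2 ⟨?_, ?_⟩, ?_, ?_⟩
  · exact linvXS hT hact hinv v₀ hfix fun f hf => hle f (cobdry_periForest hf)
  · refine raiXS hT hact v₀ (hval.subset cobdry_periForest) fun f hf => ?_
    exact hfin_iInf hY hval (fun f hf => hf.1) (cobdry_periForest hf).1
  · obtain ⟨u, rfl⟩ := hve'
    replace he' : T.Adj v u := he'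
    intro hcon
    refine half_not_hfin hT hact hinv hmin v₀ he' hfix (hcon.mono ?_)
    intro g hg
    obtain ⟨p, hp, hpv⟩ := half_cons hT he' hg
    refine mem_periForest_iff.2 ⟨.cons he' p, fun e h1 h2 h3 => ?_⟩
    rw [SimpleGraph.Walk.edges_cons, List.mem_cons] at h3
    rcases h3 with rfl | h3
    · exact he'Y h1
    · exact hpv (p.mem_support_of_mem_edges h3 h2)
  · obtain ⟨u, rfl⟩ := hve
    have heT : T.Adj v u := hY.2.1 he
    intro hcon
    refine half_not_hfin hT hact hinv hmin v₀ heT hfix (hcon.mono ?_)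
    intro g hg hgR
    obtain ⟨p, hp, hpv⟩ := half_cons hT heT hg
    obtain ⟨f, hf, hf'⟩ := cross_walk p.reverse hgR (not_mem_periForest hT heT he)
    rw [SimpleGraph.Walk.edges_reverse, List.mem_reverse] at hf
    exact hpv (p.mem_support_of_mem_edges hf (cobdry_periForest hf').2)

lemma bct_forest (v₀ : V) (Y : Set (Sym2 V)) (H : Subgroup G) (X : Set G)
    (hX : X ∈ BCT T v₀ Y H) :
    ∃ S : Set V, IsSpecialForest T S Y ∧ HFin H (X ∆ XS G v₀ S) := by
  refine hX {X | ∃ S : Set V, IsSpecialForest T S Y ∧ HFin H (X ∆ XS G v₀ S)}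
    ⟨?_, ?_, ?_, ?_⟩
  · intro u v _ hY
    refine ⟨halfTree T u v, ⟨(Set.finite_singleton _).subset cobdry_halfTree, ?_⟩, ?_⟩
    · intro e he
      have : e = s(u, v) := cobdry_halfTree he
      rwa [this]
    · refine (hfin_empty H).mono ?_
      simp [Ze]
  · rintro X ⟨S, hS, h⟩
    refine ⟨Sᶜ, by simpa [IsSpecialForest, cobdry_compl] using hS, ?_⟩
    have : XS G v₀ Sᶜ = (XS G v₀ S)ᶜ := rfl
    rw [this]
    refine h.mono ?_
    rintro x (⟨h1, h2⟩ | ⟨h1, h2⟩)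
    · exact Or.inr ⟨not_not.1 h2, h1⟩
    · exact Or.inl ⟨not_not.1 h2, h1⟩
  · rintro X ⟨S, hS, h⟩ X' ⟨S', hS', h'⟩
    refine ⟨S ∩ S', ⟨(hS.1.union hS'.1).subset (cobdry_inter S S'),
      (cobdry_inter S S').trans (Set.union_subset hS.2 hS'.2)⟩, (h.union h').mono ?_⟩
    have : XS G v₀ (S ∩ S') = XS G v₀ S ∩ XS G v₀ S' := rfl
    rw [this]
    rintro x (⟨⟨h1, h2⟩, h3⟩ | ⟨⟨h1, h2⟩, h3⟩)
    · by_cases h4 : x ∈ XS G v₀ S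
      · exact Or.inr (Or.inl ⟨h2, fun h5 => h3 ⟨h4, h5⟩⟩)
      · exact Or.inl (Or.inl ⟨h1, h4⟩)
    · by_cases h4 : x ∈ X
      · exact Or.inr (Or.inr ⟨h2, fun h5 => h3 ⟨h4, h5⟩⟩)
      · exact Or.inl (Or.inr ⟨h1, h4⟩)
  · rintro X ⟨S, hS, h⟩ X' hXX'
    refine ⟨S, hS, (h.union hXX').mono ?_⟩
    rw [Set.union_comm, symmDiff_comm X X']
    exact symmDiff_triangle X' X _

end TreeLemmas

section Final
variable {G V : Type*} [Group G] [MulAction G V] {T : SimpleGraph V}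

lemma not_cross_BT (hT : T.IsTree) (hact : ActsOn T G) (hinv : NoInversions T G)
    {E : Set (Subgroup G)} (hE : Admissible E) (hET : IsETree T G E)
    (hmin : MinimalAction T G) (v₀ : V)
    {Y : Set (Sym2 V)} (hY : IsCylinder T G Y) {v : V}
    (hn : NontrivAI (periStab G Y v) (XvY T G v₀ Y v))
    {Z : Set G} (hZ : Z ∈ NontrivB T G v₀) :
    ¬ Crosses (periStab G Y v) (XvY T G v₀ Y v) Z := by
  obtain ⟨⟨Y', hY', e, he, hZB⟩, K, hK⟩ := hZ
  obtain ⟨S, hS, hSZ⟩ := bct_forest v₀ Y' _ Z hZB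
  have hKai := (isAI_iff _ _).1 hK.1
  have hXai := (isAI_iff _ _).1 hn.1
  have heT := hY'.2.1 he
  have hJ : ¬ HFin (edgeStab G e) (Set.univ : Set G) := by
    intro hcon
    induction e using Sym2.ind with
    | _ a b =>
      exact half_not_hfin hT hact hinv hmin v₀ (show T.Adj a b from heT)
        (fun k hk => edgeStab_fix hinv heT hk (Sym2.mem_mk_left a b))
        (hcon.mono (Set.subset_univ _))
  have hZ1 : ¬ HFin (edgeStab G e) Z := fun h => hK.2.1 (neumann hJ hKai.2 h)
  have hZ2 : ¬ HFin (edgeStab G e) Zᶜ := fun h => hK.2.2 (neumann hJ hKai.2.compl h)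
  set F : Set (Sym2 V) := insert e (cobdry T S) with hF
  have hFfin : F.Finite := hS.1.insert e
  have hFY : F ⊆ Y' := Set.insert_subset he hS.2
  set J₀ : Subgroup G := ⨅ f ∈ F, edgeStab G f with hJ₀
  have hle : ∀ f ∈ F, J₀ ≤ edgeStab G f := fun f hf => iInf₂_le f hf
  have hJ₀J : HFin J₀ (edgeStab G e : Set G) := hfin_iInf hY' hFfin hFY he
  have hJJ₀ : HFin (edgeStab G e) (J₀ : Set G) := HFin.of_le (hle e (Set.mem_insert _ _))
  have hl : LInv J₀ (XS G v₀ S) := by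
    obtain ⟨x, hx⟩ : ∃ x, x ∈ e := by
      induction e using Sym2.ind with
      | _ a b => exact ⟨a, Sym2.mem_mk_left _ _⟩
    exact linvXS hT hact hinv v₀ (x := x)
      (fun k hk => edgeStab_fix hinv heT (hle e (Set.mem_insert _ _) hk) hx)
      (fun f hf => hle f (Set.mem_insert_of_mem _ hf))
  have hKJ : HFin K (edgeStab G e : Set G) := by
    have h1 : HFin K (J₀ : Set G) := by
      refine comm2 hl ?_ ?_ (symmDiff_comm Z _ ▸ hJ₀J.trans hSZ) hKai.2
      · intro h
        refine hZ1 (((hJJ₀.trans h).union hSZ).mono fun x hx => ?_)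
        by_cases hxS : x ∈ XS G v₀ S
        · exact Or.inl hxS
        · exact Or.inr (Or.inl ⟨hx, hxS⟩)
      · intro h
        refine hZ2 (((hJJ₀.trans h).union hSZ).mono fun x hx => ?_)
        by_cases hxS : x ∈ XS G v₀ S
        · exact Or.inr (Or.inr ⟨hxS, hx⟩)
        · exact Or.inl hxS
    exact h1.trans hJ₀J
  have corner : ∀ X' Z' : Set G, NontrivAI (periStab G Y v) X' → NontrivAI K Z' →
      HFin (edgeStab G e) (X' ∩ Z') → HFin (periStab G Y v) (X' ∩ Z') := by
    intro X' Z' hX' hZ' h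
    rw [Set.inter_comm] at h ⊢
    exact corner_symm ((isAI_iff _ _).1 hZ'.1).1 hZ'.2.1 ((isAI_iff _ _).1 hX'.1).2 (hKJ.trans h)
  rintro ⟨c1, c2, c3, c4⟩
  rcases forest_nested hT hact hinv hE hET hY v hY' hS.2 with h | h | h | h
  · refine c1 (corner _ _ hn hK (hSZ.mono ?_))
    rintro x ⟨hx, hxZ⟩
    exact Or.inl ⟨hxZ, fun hxS => Set.eq_empty_iff_forall_notMem.1 h (x • v₀) ⟨hx, hxS⟩⟩
  · refine c2 (corner _ _ hn hK.compl (hSZ.mono ?_))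
    rintro x ⟨hx, hxZ⟩
    refine Or.inr ⟨?_, hxZ⟩
    by_contra hxS
    exact Set.eq_empty_iff_forall_notMem.1 h (x • v₀) ⟨hx, hxS⟩
  · refine c3 (corner _ _ hn.compl hK (hSZ.mono ?_))
    rintro x ⟨hx, hxZ⟩
    exact Or.inl ⟨hxZ, fun hxS => Set.eq_empty_iff_forall_notMem.1 h (x • v₀) ⟨hx, hxS⟩⟩
  · refine c4 (corner _ _ hn.compl hK.compl (hSZ.mono ?_))
    rintro x ⟨hx, hxZ⟩
    refine Or.inr ⟨?_, hxZ⟩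
    by_contra hxS
    exact Set.eq_empty_iff_forall_notMem.1 h (x • v₀) ⟨hx, hxS⟩

/-- `X` and `Z` are equivalent up to complement. -/
def PEq (H : Subgroup G) (X Z : Set G) : Prop := HFin H (X ∆ Z) ∨ HFin H (X ∆ Zᶜ)

lemma symmDiff_compl_compl' (X Z : Set G) : Xᶜ ∆ Zᶜ = X ∆ Z := by
  ext x
  simp only [Set.mem_symmDiff, Set.mem_compl_iff]
  tauto

lemma PEq.symm {H : Subgroup G} {X Z : Set G} (h : PEq H X Z) : PEq H Z X := by
  rcases h with h | h
  · left; rwa [symmDiff_comm]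
  · right
    rw [← symmDiff_compl_compl', compl_compl, symmDiff_comm]; exact h

lemma PEq.trans {H : Subgroup G} {X Z W : Set G} (h : PEq H X Z) (h' : PEq H Z W) :
    PEq H X W := by
  have key : ∀ A B C : Set G, HFin H (A ∆ B) → HFin H (B ∆ C) → HFin H (A ∆ C) :=
    fun A B C h h' => (h.union h').mono (symmDiff_triangle A B C)
  rcases h with h | h <;> rcases h' with h' | h'
  · exact Or.inl (key _ _ _ h h')
  · exact Or.inr (key _ _ _ h h')
  · exact Or.inr (key _ _ _ h (by rwa [symmDiff_compl_compl']))
  · refine Or.inl (key _ _ _ h ?_)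
    rw [← symmDiff_compl_compl', compl_compl]; exact h'

lemma PEq.of_trans {H K : Subgroup G} {X Z : Set G} (h : PEq K X Z) (hK : HFin H (K : Set G)) :
    PEq H X Z := h.imp hK.trans hK.trans

lemma step_iff (v₀ : V) {H : Subgroup G} {X : Set G} (hn : NontrivAI H X)
    (hX : ∀ Z ∈ NontrivB T G v₀, ¬ Crosses H X Z) {Z Z' : Set G} (h : ccStep T G v₀ Z Z') :
    PEq H X Z ↔ PEq H X Z' := by
  have nocross : ∀ {K K' : Subgroup G} {A B : Set G}, NontrivAI K A → NontrivAI K' B →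
      B ∈ NontrivB T G v₀ → Crosses K A B → ¬ PEq H X A := by
    intro K K' A B hA hB hBB hc hP
    have hc' := crosses_trans hc (comm12 hn hA hP).2
    apply hX B hBB
    rcases hP with hP | hP
    · exact crosses_equiv hc' hP
    · refine crosses_equiv (crosses_compl (X := Aᶜ) (by rwa [compl_compl])) hP
  obtain ⟨hZ, hZ', hc | hs⟩ := h
  · obtain ⟨K, K', hK, hK', hc⟩ := hc
    have h1 := nocross hK hK' hZ' hc
    have h2 := nocross hK' hK hZ (crosses_symm hK hK' hc)
    tauto
  · obtain ⟨K, hK, hs⟩ := hs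
    have hs' : PEq K Z Z' := hs
    constructor
    · intro hP
      exact hP.trans (hs'.of_trans (comm12 hn hK hP).1)
    · intro hP
      obtain ⟨-, K', hK'⟩ := hZ'
      have h1 := (comm12 hn hK' hP).1
      have h2 := (comm12 hK hK' hs').2
      exact hP.trans (hs'.of_trans (h1.trans h2)).symm

end Final

end SSRN

namespace SSRN

variable {G V : Type*} [Group G] [MulAction G V]

/-- The peripheral almost invariant set `X_{v,Y}` is non-trivial, crosses
no `X_S` for `S` a special forest, and consequently its pair forms a complete
cross-connected component of `B(T)`. -/
theorem stmt_8 (hGfg : Group.FG G)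
    (T : SimpleGraph V) (hT : T.IsTree) (hact : ActsOn T G) (hinv : NoInversions T G)
    (E : Set (Subgroup G)) (hE : Admissible E) (hET : IsETree T G E)
    (hmin : MinimalAction T G) (v₀ : V)
    (Y : Set (Sym2 V)) (hY : IsCylinder T G Y)
    (v : V) (hv : v ∈ cylBoundary T Y) (hval : FiniteValenceIn Y v) :
    -- `X_{v,Y}` is a non-trivial almost invariant set
    NontrivAI (periStab G Y v) (XvY T G v₀ Y v) ∧
    -- it crosses no `X_S`
    (∀ (S : Set V) (Y' : Set (Sym2 V)), IsCylinder T G Y' → IsSpecialForest T S Y' →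
      ¬ Crosses (periStab G Y v) (XvY T G v₀ Y v) (XS G v₀ S)) ∧
    -- consequently `{{[X_{v,Y}], [X_{v,Y}*]}}` is a complete cross-connected component
    (∀ X' ∈ NontrivB T G v₀, ccRel T G v₀ (XvY T G v₀ Y v) X' →
      HFin (periStab G Y v) (XvY T G v₀ Y v ∆ X') ∨
        HFin (periStab G Y v) (XvY T G v₀ Y v ∆ X'ᶜ)) := by
  have hn := peri_nontriv hT hact hinv hmin v₀ Y hY v hv hval
  refine ⟨hn, ?_, ?_⟩
  · intro S Y' hY' hS
    rintro ⟨c1, c2, c3, c4⟩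
    rcases forest_nested hT hact hinv hE hET hY v hY' hS.2 with h | h | h | h
    · exact c1 ((hfin_empty _).mono fun x hx => (Set.eq_empty_iff_forall_notMem.1 h (x • v₀) hx).elim)
    · exact c2 ((hfin_empty _).mono fun x hx => (Set.eq_empty_iff_forall_notMem.1 h (x • v₀) hx).elim)
    · exact c3 ((hfin_empty _).mono fun x hx => (Set.eq_empty_iff_forall_notMem.1 h (x • v₀) hx).elim)
    · exact c4 ((hfin_empty _).mono fun x hx => (Set.eq_empty_iff_forall_notMem.1 h (x • v₀) hx).elim)
  · intro X' _ hrel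
    have key : ∀ A B : Set G, ccRel T G v₀ A B →
        (PEq (periStab G Y v) (XvY T G v₀ Y v) A ↔ PEq (periStab G Y v) (XvY T G v₀ Y v) B) := by
      intro A B hAB
      induction hAB with
      | rel A B h =>
        exact step_iff v₀ hn (fun Z hZ => not_cross_BT hT hact hinv hE hET hmin v₀ hY hn hZ) h
      | refl A => exact Iff.rfl
      | symm A B _ ih => exact ih.symm
      | trans A B C _ _ ih1 ih2 => exact ih1.trans ih2
    exact (key _ _ hrel).1 (Or.inl ((hfin_empty _).mono (by simp)))

end SSRN
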